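/- arXiv:2402.18845 — 6 statements merged into one kernel-verified Lean document; each statement's English description precedes it below -/
import Mathlib

section
/- Let p, q, t be positive real numbers satisfying the triangle inequalities p < q + t, q < t + p, and t < p + q. Then −1 < (cosh p · cosh q − cosh t)/(sinh p · sinh q) < 1. -/
open Real

theorem cos_angle_valid (p q t : ℝ) (hp : 0 < p) (hq : 0 < q) (ht : 0 < t)
    (h1 : p < q + t) (h2 : q < t + p) (h3 : t < p + q) :
    -1 < (cosh p * cosh q - cosh t) / (sinh p * sinh q) ∧
    (cosh p * cosh q - cosh t) / (sinh p * sinh q) < 1 := by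
  have hpos : 0 < sinh p * sinh q := mul_pos (sinh_pos_iff.2 hp) (sinh_pos_iff.2 hq)
  have h_add : cosh t < cosh (p + q) := by
    rw [cosh_lt_cosh, abs_of_pos ht, abs_of_pos (add_pos hp hq)]
    exact h3
  have h_sub : cosh (p - q) < cosh t := by
    rw [cosh_lt_cosh, abs_of_pos ht, abs_lt]
    constructor <;> linarith
  rw [cosh_add] at h_add
  rw [cosh_sub] at h_sub
  rw [lt_div_iff₀ hpos, div_lt_one hpos]
  constructor <;> linarith
end

section
/- Let p, q, t be positive real numbers satisfying the triangle inequalities p < q + t, q < t + p, and t < p + q. Define α = arccos((cosh q · cosh t − cosh p)/(sinh q · sinh t)), β = arccos((cosh t · cosh p − cosh q)/(sinh t · sinh p)), and γ = arccos((cosh p · cosh q − cosh t)/(sinh p · sinh q)). Then α + β + γ < π. -/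
open Real

theorem abs_cosh_mul_cosh_sub_cosh_lt {p q t : ℝ} (hp : 0 < p)
    (h1 : p < q + t) (h2 : q < t + p) (h3 : t < p + q) :
    |cosh q * cosh t - cosh p| < sinh q * sinh t := by
  have hadd : cosh p < cosh (q + t) := by
    rw [cosh_lt_cosh, abs_of_pos hp, abs_of_pos (by linarith)]
    exact h1
  have hsub : cosh (q - t) < cosh p := by
    rw [cosh_lt_cosh, abs_of_pos hp, abs_lt]
    constructor <;> linarith
  rw [cosh_add] at hadd
  rw [cosh_sub] at hsub
  rw [abs_lt]
  constructor <;> linarith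

/-- The Gram determinant attached to a nondegenerate hyperbolic triangle is positive. -/
theorem cosh_gram_pos {p q t : ℝ} (hp : 0 < p)
    (h1 : p < q + t) (h2 : q < t + p) (h3 : t < p + q) :
    0 < 1 + 2 * cosh p * cosh q * cosh t - cosh p ^ 2 - cosh q ^ 2 - cosh t ^ 2 := by
  obtain ⟨hsub, hadd⟩ := abs_lt.1 (abs_cosh_mul_cosh_sub_cosh_lt hp h1 h2 h3)
  have := mul_pos (sub_pos.2 hadd) (sub_pos.2 hsub)
  linear_combination this + sinh t ^ 2 * sinh_sq q + (cosh q ^ 2 - 1) * sinh_sq t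

/-- The sine of an angle given by the hyperbolic law of cosines. -/
theorem sin_arccos_hyperbolic {p q t : ℝ} (hq : 0 < q) (ht : 0 < t) :
    sin (arccos ((cosh q * cosh t - cosh p) / (sinh q * sinh t))) =
      √(1 + 2 * cosh p * cosh q * cosh t - cosh p ^ 2 - cosh q ^ 2 - cosh t ^ 2) /
        (sinh q * sinh t) := by
  have hsq := sinh_pos_iff.2 hq
  have hst := sinh_pos_iff.2 ht
  rw [sin_arccos, ← sqrt_sq (mul_pos hsq hst).le, ← sqrt_div' _ (sq_nonneg _),
    sqrt_sq (mul_pos hsq hst).le]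
  congr 1
  field_simp
  rw [sinh_sq, sinh_sq]
  ring

/-- The cosine of an angle given by the hyperbolic law of cosines. -/
theorem cos_arccos_hyperbolic {p q t : ℝ} (hp : 0 < p) (hq : 0 < q) (ht : 0 < t)
    (h1 : p < q + t) (h2 : q < t + p) (h3 : t < p + q) :
    cos (arccos ((cosh q * cosh t - cosh p) / (sinh q * sinh t))) =
      (cosh q * cosh t - cosh p) / (sinh q * sinh t) := by
  have hs : 0 < sinh q * sinh t := mul_pos (sinh_pos_iff.2 hq) (sinh_pos_iff.2 ht)
  obtain ⟨hsub, hadd⟩ := abs_lt.1 (abs_cosh_mul_cosh_sub_cosh_lt hp h1 h2 h3)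
  apply cos_arccos
  · rw [le_div_iff₀ hs]
    linarith
  · rw [div_le_iff₀ hs]
    linarith

theorem hyperbolic_angle_sum_lt_pi (p q t : ℝ) (hp : 0 < p) (hq : 0 < q) (ht : 0 < t)
    (h1 : p < q + t) (h2 : q < t + p) (h3 : t < p + q)
    (α β γ : ℝ)
    (hα : α = arccos ((cosh q * cosh t - cosh p) / (sinh q * sinh t)))
    (hβ : β = arccos ((cosh t * cosh p - cosh q) / (sinh t * sinh p)))
    (hγ : γ = arccos ((cosh p * cosh q - cosh t) / (sinh p * sinh q))) :
    α + β + γ < π := by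
  have hD := cosh_gram_pos hp h1 h2 h3
  have hsp := sinh_pos_iff.2 hp
  have hsq := sinh_pos_iff.2 hq
  have hst := sinh_pos_iff.2 ht
  have hcα : cos α = _ := hα ▸ cos_arccos_hyperbolic hp hq ht h1 h2 h3
  have hcβ : cos β = _ := hβ ▸ cos_arccos_hyperbolic hq ht hp h2 h3 h1
  have hcγ : cos γ = _ := hγ ▸ cos_arccos_hyperbolic ht hp hq h3 h1 h2
  have hsα : sin α = _ := hα ▸ sin_arccos_hyperbolic hq ht
  have hsβ : sin β = _ := hβ ▸ sin_arccos_hyperbolic ht hp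
  have hα0 : 0 ≤ α := hα ▸ arccos_nonneg _
  have hβ0 : 0 ≤ β := hβ ▸ arccos_nonneg _
  have hβπ : β ≤ π := hβ ▸ arccos_le_pi _
  have hαπ : α ≤ π := hα ▸ arccos_le_pi _
  have hγ0 : 0 ≤ γ := hγ ▸ arccos_nonneg _
  have hγπ : γ ≤ π := hγ ▸ arccos_le_pi _
  have hcos_add : 0 < cos α + cos β := by
    have hlt : cosh (p - q) < cosh t := by
      rw [cosh_lt_cosh, abs_of_pos ht, abs_lt]
      constructor <;> linarith
    have hpos := mul_pos (sinh_pos_iff.2 (add_pos hp hq)) (sub_pos.2 hlt)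
    have key : cos α + cos β =
        sinh (p + q) * (cosh t - cosh (p - q)) / (sinh p * sinh q * sinh t) := by
      rw [hcα, hcβ, sinh_add, cosh_sub]
      field_simp
      linear_combination (sinh q * cosh q) * cosh_sq p + (sinh p * cosh p) * cosh_sq q
    rw [key]
    positivity
  have hαβ : α + β < π := by
    by_contra! h
    have := cos_le_cos_of_nonneg_of_le_pi (x := π - β) (y := α) (by linarith) hαπ (by linarith)
    rw [cos_pi_sub] at this
    linarith
  have hdual : 0 < cos (α + β) + cos γ := by
    have key : cos (α + β) + cos γ = (cosh t - 1) *
        (1 + 2 * cosh p * cosh q * cosh t - cosh p ^ 2 - cosh q ^ 2 - cosh t ^ 2) /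
          (sinh p * sinh q * sinh t ^ 2) := by
      have hperm : 1 + 2 * cosh q * cosh t * cosh p - cosh q ^ 2 - cosh t ^ 2 - cosh p ^ 2 =
          1 + 2 * cosh p * cosh q * cosh t - cosh p ^ 2 - cosh q ^ 2 - cosh t ^ 2 := by ring
      rw [cos_add, hcα, hcβ, hcγ, hsα, hsβ, hperm]
      have hsqrt := sq_sqrt hD.le
      generalize √(1 + 2 * cosh p * cosh q * cosh t - cosh p ^ 2 - cosh q ^ 2 - cosh t ^ 2) = r
        at hsqrt ⊢
      field_simp
      rw [hsqrt, sinh_sq t]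
      ring
    have hct : 0 < cosh t - 1 := sub_pos.2 (one_lt_cosh.2 ht.ne')
    rw [key]
    positivity
  by_contra! h
  have := cos_le_cos_of_nonneg_of_le_pi (x := π - γ) (y := α + β)
    (by linarith) hαβ.le (by linarith)
  rw [cos_pi_sub] at this
  linarith
end

section
/- (Hyperbolic law of sines, analytic form.) Let p, q, t be positive real numbers satisfying the triangle inequalities p < q + t, q < t + p, and t < p + q. Define α = arccos((cosh q · cosh t − cosh p)/(sinh q · sinh t)), β = arccos((cosh t · cosh p − cosh q)/(sinh t · sinh p)), and γ = arccos((cosh p · cosh q − cosh t)/(sinh p · sinh q)). Then sinh p / sin α = sinh q / sin β = sinh t / sin γ. -/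
open Real

/-- The sine of an angle of a hyperbolic triangle, in terms of the Gram determinant of its
side lengths, which is symmetric in the three sides. -/
theorem sin_arccos_hyperbolic_angle {x y : ℝ} (hx : 0 < x) (hy : 0 < y) (z : ℝ) :
    sin (arccos ((cosh x * cosh y - cosh z) / (sinh x * sinh y))) =
      √(1 - cosh x ^ 2 - cosh y ^ 2 - cosh z ^ 2 + 2 * cosh x * cosh y * cosh z) /
        (sinh x * sinh y) := by
  have hsx : 0 < sinh x := sinh_pos_iff.mpr hx
  have hsy : 0 < sinh y := sinh_pos_iff.mpr hy
  have hxy : 0 < sinh x * sinh y := mul_pos hsx hsy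
  rw [sin_arccos, ← sqrt_sq hxy.le, ← sqrt_div' _ (sq_nonneg _), sqrt_sq hxy.le]
  congr 1
  rw [div_pow, eq_div_iff (pow_pos hxy 2).ne', sub_mul, div_mul_cancel₀ _ (pow_pos hxy 2).ne',
    mul_pow, sinh_sq, sinh_sq]
  ring

/-- The common value of the ratios in the hyperbolic law of sines. -/
theorem sinh_div_sin_arccos_hyperbolic_angle {x y : ℝ} (hx : 0 < x) (hy : 0 < y) (z : ℝ) :
    sinh z / sin (arccos ((cosh x * cosh y - cosh z) / (sinh x * sinh y))) =
      sinh x * sinh y * sinh z /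
        √(1 - cosh x ^ 2 - cosh y ^ 2 - cosh z ^ 2 + 2 * cosh x * cosh y * cosh z) := by
  rw [sin_arccos_hyperbolic_angle hx hy, div_div_eq_mul_div, mul_comm (sinh z)]

theorem hyperbolic_law_of_sines (p q t : ℝ) (hp : 0 < p) (hq : 0 < q) (ht : 0 < t)
    (h1 : p < q + t) (h2 : q < t + p) (h3 : t < p + q)
    (α β γ : ℝ)
    (hα : α = arccos ((cosh q * cosh t - cosh p) / (sinh q * sinh t)))
    (hβ : β = arccos ((cosh t * cosh p - cosh q) / (sinh t * sinh p)))
    (hγ : γ = arccos ((cosh p * cosh q - cosh t) / (sinh p * sinh q))) :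
    sinh p / sin α = sinh q / sin β ∧ sinh q / sin β = sinh t / sin γ := by
  subst hα hβ hγ
  rw [sinh_div_sin_arccos_hyperbolic_angle hq ht, sinh_div_sin_arccos_hyperbolic_angle ht hp,
    sinh_div_sin_arccos_hyperbolic_angle hp hq]
  constructor <;> ring_nf
end

section
/- (Second hyperbolic law of cosines, analytic form.) Let p, q, t be positive real numbers satisfying the triangle inequalities p < q + t, q < t + p, and t < p + q. Define α = arccos((cosh q · cosh t − cosh p)/(sinh q · sinh t)), β = arccos((cosh t · cosh p − cosh q)/(sinh t · sinh p)), and γ = arccos((cosh p · cosh q − cosh t)/(sinh p · sinh q)). Then cos γ = −cos α · cos β + sin α · sin β · cosh t. -/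
open Real

/-- The cosine rule expression for a hyperbolic angle lies in `[-1, 1]`. -/
lemma abs_hyperbolic_cos_rule_le_one {p q t : ℝ} (hp : 0 < p) (hq : 0 < q) (ht : 0 < t)
    (h1 : p < q + t) (h2 : q < t + p) (h3 : t < p + q) :
    |(cosh q * cosh t - cosh p) / (sinh q * sinh t)| ≤ 1 := by
  have hs : 0 < sinh q * sinh t := mul_pos (sinh_pos_iff.2 hq) (sinh_pos_iff.2 ht)
  have hadd : cosh p ≤ cosh (q + t) := by
    rw [cosh_le_cosh, abs_of_pos hp, abs_of_pos (add_pos hq ht)]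
    exact h1.le
  have hsub : cosh (q - t) ≤ cosh p := by
    rw [cosh_le_cosh, abs_of_pos hp, abs_le]
    constructor <;> linarith
  rw [cosh_add] at hadd
  rw [cosh_sub] at hsub
  rw [abs_le, le_div_iff₀ hs, div_le_one hs]
  constructor <;> linarith

/-- The sine of a hyperbolic angle in terms of the Gram determinant of the side lengths. -/
lemma sin_arccos_hyperbolic_cos_rule {p q t : ℝ} (hq : 0 < q) (ht : 0 < t) :
    sin (arccos ((cosh q * cosh t - cosh p) / (sinh q * sinh t))) =
      √(1 - cosh p ^ 2 - cosh q ^ 2 - cosh t ^ 2 + 2 * cosh p * cosh q * cosh t) /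
        (sinh q * sinh t) := by
  have hq' := sinh_pos_iff.2 hq
  have ht' := sinh_pos_iff.2 ht
  rw [sin_arccos, ← sqrt_sq (mul_pos hq' ht').le, ← sqrt_div' _ (sq_nonneg _),
    sqrt_sq (mul_pos hq' ht').le]
  congr 1
  field_simp
  rw [sinh_sq, sinh_sq]
  ring

theorem second_hyperbolic_law_of_cosines (p q t : ℝ) (hp : 0 < p) (hq : 0 < q) (ht : 0 < t)
    (h1 : p < q + t) (h2 : q < t + p) (h3 : t < p + q)
    (α β γ : ℝ)
    (hα : α = arccos ((cosh q * cosh t - cosh p) / (sinh q * sinh t)))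
    (hβ : β = arccos ((cosh t * cosh p - cosh q) / (sinh t * sinh p)))
    (hγ : γ = arccos ((cosh p * cosh q - cosh t) / (sinh p * sinh q))) :
    cos γ = -cos α * cos β + sin α * sin β * cosh t := by
  have hp' := sinh_pos_iff.2 hp
  have hq' := sinh_pos_iff.2 hq
  have ht' := sinh_pos_iff.2 ht
  have hx := abs_hyperbolic_cos_rule_le_one hp hq ht h1 h2 h3
  have hy := abs_le.1 (abs_hyperbolic_cos_rule_le_one hq ht hp h2 h3 h1)
  have hz := abs_le.1 (abs_hyperbolic_cos_rule_le_one ht hp hq h3 h1 h2)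
  set D := 1 - cosh p ^ 2 - cosh q ^ 2 - cosh t ^ 2 + 2 * cosh p * cosh q * cosh t with hD
  have hD0 : 0 ≤ D := by
    rw [abs_div, abs_of_pos (mul_pos hq' ht'), div_le_one (mul_pos hq' ht')] at hx
    have hsq := sq_le_sq' (abs_le.1 hx).1 (abs_le.1 hx).2
    rw [mul_pow, sinh_sq, sinh_sq] at hsq
    linarith
  have hsinα : sin α = √D / (sinh q * sinh t) := by
    rw [hα, sin_arccos_hyperbolic_cos_rule hq ht]
  have hsinβ : sin β = √D / (sinh t * sinh p) := by
    rw [hβ, sin_arccos_hyperbolic_cos_rule ht hp, hD]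
    ring_nf
  rw [hsinα, hsinβ, div_mul_div_comm, mul_self_sqrt hD0, hα, hβ, hγ,
    cos_arccos (abs_le.1 hx).1 (abs_le.1 hx).2, cos_arccos hy.1 hy.2, cos_arccos hz.1 hz.2, hD]
  field_simp
  rw [sinh_sq]
  ring
end

section
/- Let β₁, δ₁ ∈ (0, π) with β₁ + δ₁ < π, and let b > 0 be such that sin β₁ · sin δ₁ · cosh b − cos β₁ · cos δ₁ < 1. Then −cos β₁ · cos δ₁ + sin β₁ · sin δ₁ · cosh b > −1, and the angle α := arccos(−cos β₁ · cos δ₁ + sin β₁ · sin δ₁ · cosh b) satisfies 0 < α and α + β₁ + δ₁ < π. -/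
open Real Set

theorem third_angle_sum_lt_pi (β₁ δ₁ b : ℝ)
    (hβ₁ : β₁ ∈ Ioo 0 π) (hδ₁ : δ₁ ∈ Ioo 0 π) (hsum : β₁ + δ₁ < π)
    (hb : 0 < b)
    (hlt : sin β₁ * sin δ₁ * cosh b - cos β₁ * cos δ₁ < 1) :
    -1 < -cos β₁ * cos δ₁ + sin β₁ * sin δ₁ * cosh b ∧
    0 < arccos (-cos β₁ * cos δ₁ + sin β₁ * sin δ₁ * cosh b) ∧
    arccos (-cos β₁ * cos δ₁ + sin β₁ * sin δ₁ * cosh b) + β₁ + δ₁ < π := by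
  obtain ⟨hβ0, hβπ⟩ := hβ₁
  obtain ⟨hδ0, hδπ⟩ := hδ₁
  have hsin : 0 < sin β₁ * sin δ₁ :=
    mul_pos (sin_pos_of_pos_of_lt_pi hβ0 hβπ) (sin_pos_of_pos_of_lt_pi hδ0 hδπ)
  have hcosh : 1 < cosh b := Real.one_lt_cosh.2 hb.ne'
  have hcos : cos (π - (β₁ + δ₁)) < -cos β₁ * cos δ₁ + sin β₁ * sin δ₁ * cosh b := by
    rw [cos_pi_sub, cos_add]
    nlinarith [mul_lt_mul_of_pos_left hcosh hsin]
  have hlt_one : -cos β₁ * cos δ₁ + sin β₁ * sin δ₁ * cosh b < 1 := by linarith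
  refine ⟨(neg_one_le_cos _).trans_lt hcos, arccos_pos.2 hlt_one, ?_⟩
  have harccos := arccos_lt_arccos (neg_one_le_cos _) hcos hlt_one.le
  rw [arccos_cos (by linarith) (by linarith)] at harccos
  linarith
end

section
/- (Quadrilateral rigidity lemma, analytic form.) Fix positive reals p, q, r, s. For t with max(|p−q|, |r−s|) < t < min(p+q, r+s), define α(t) = arccos((cosh p · cosh q − cosh t)/(sinh p · sinh q)), γ(t) = arccos((cosh r · cosh s − cosh t)/(sinh r · sinh s)), β(t) = arccos((cosh q · cosh t − cosh p)/(sinh q · sinh t)) + arccos((cosh r · cosh t − cosh s)/(sinh r · sinh t)), δ(t) = arccos((cosh p · cosh t − cosh q)/(sinh p · sinh t)) + arccos((cosh s · cosh t − cosh r)/(sinh s · sinh t)). If t and t′ are both admissible and α(t) + β(t) + γ(t) + δ(t) = α(t′) + β(t′) + γ(t′) + δ(t′) and α(t) − β(t) + γ(t) − δ(t) = α(t′) − β(t′) + γ(t′) − δ(t′), then t = t′ (and hence all four angles agree). -/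
open Real Set

/-- In a hyperbolic triangle with two fixed sides `a`, `b`, the angle between them is a strictly
increasing function of the opposite side. -/
theorem strictMonoOn_hyperbolic_angle {a b : ℝ} (ha : 0 < a) (hb : 0 < b) :
    StrictMonoOn (fun t => arccos ((cosh a * cosh b - cosh t) / (sinh a * sinh b)))
      (Ioo |a - b| (a + b)) := by
  have hab : 0 < sinh a * sinh b := mul_pos (sinh_pos_iff.2 ha) (sinh_pos_iff.2 hb)
  have arg_mem : ∀ t ∈ Ioo |a - b| (a + b),
      (cosh a * cosh b - cosh t) / (sinh a * sinh b) ∈ Icc (-1 : ℝ) 1 := by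
    rintro t ⟨hlo, hhi⟩
    have ht : 0 < t := (abs_nonneg _).trans_lt hlo
    have hsub : cosh (a - b) < cosh t := cosh_lt_cosh.2 (by rwa [abs_of_pos ht])
    have hadd : cosh t < cosh (a + b) :=
      cosh_lt_cosh.2 (by rwa [abs_of_pos ht, abs_of_pos (add_pos ha hb)])
    rw [cosh_sub] at hsub
    rw [cosh_add] at hadd
    constructor
    · rw [le_div_iff₀ hab]
      linarith
    · rw [div_le_iff₀ hab]
      linarith
  intro t ht u hu htu
  have ht0 : 0 < t := (abs_nonneg _).trans_lt ht.1
  have hcosh : cosh t < cosh u :=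
    cosh_lt_cosh.2 (by rwa [abs_of_pos ht0, abs_of_pos (ht0.trans htu)])
  refine strictAntiOn_arccos (arg_mem u hu) (arg_mem t ht) ?_
  gcongr

theorem quadrilateral_rigidity (p q r s : ℝ)
    (hp : 0 < p) (hq : 0 < q) (hr : 0 < r) (hs : 0 < s)
    (α β γ δ : ℝ → ℝ)
    (hα : ∀ t, α t = arccos ((cosh p * cosh q - cosh t) / (sinh p * sinh q)))
    (hγ : ∀ t, γ t = arccos ((cosh r * cosh s - cosh t) / (sinh r * sinh s)))
    (hβ : ∀ t, β t = arccos ((cosh q * cosh t - cosh p) / (sinh q * sinh t)) +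
                     arccos ((cosh r * cosh t - cosh s) / (sinh r * sinh t)))
    (hδ : ∀ t, δ t = arccos ((cosh p * cosh t - cosh q) / (sinh p * sinh t)) +
                     arccos ((cosh s * cosh t - cosh r) / (sinh s * sinh t)))
    (t t' : ℝ)
    (ht : max |p - q| |r - s| < t ∧ t < min (p + q) (r + s))
    (ht' : max |p - q| |r - s| < t' ∧ t' < min (p + q) (r + s))
    (hsum : α t + β t + γ t + δ t = α t' + β t' + γ t' + δ t')
    (halt : α t - β t + γ t - δ t = α t' - β t' + γ t' - δ t') :
    t = t' := by
  have mem {x : ℝ} (hx : max |p - q| |r - s| < x ∧ x < min (p + q) (r + s)) :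
      x ∈ Ioo |p - q| (p + q) ∩ Ioo |r - s| (r + s) := by
    obtain ⟨hlo, hhi⟩ := hx
    rw [max_lt_iff] at hlo
    rw [lt_min_iff] at hhi
    exact ⟨⟨hlo.1, hhi.1⟩, hlo.2, hhi.2⟩
  have hmono : StrictMonoOn (fun x => α x + γ x)
      (Ioo |p - q| (p + q) ∩ Ioo |r - s| (r + s)) := by
    simp only [hα, hγ]
    exact ((strictMonoOn_hyperbolic_angle hp hq).mono inter_subset_left).add
      ((strictMonoOn_hyperbolic_angle hr hs).mono inter_subset_right)
  exact hmono.injOn (mem ht) (mem ht') (by linarith)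
end
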